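/- arXiv:2508.12971 — 3 statements merged into one kernel-verified Lean document; each statement's English description precedes it below -/
import Mathlib

section
/- Let (M, I(M)) be a pi-space of finite rank. Then L(M, I(M)) is a ranked, atomistic and semimodular lattice: (1) L(M, I(M)) is a lattice with rank function rk; (2) every flat is the join of the atoms below it; (3) for all flats F, G one has rk(F) + rk(G) ≥ rk(F ∨ G) + rk(F ∧ G). -/
open Set

/-- A pre-independence space (pi-space): a non-empty ground set `M` together with a
non-empty collection `Ind` of subsets of `M` (the independent sets) that is closed
under taking subsets (I1) and satisfies the finite exchange property (I2). -/
structure PiSpace (α : Type*) where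
  M : Set α
  Ind : Set (Set α)
  M_nonempty : M.Nonempty
  Ind_nonempty : Ind.Nonempty
  ind_subset_M : ∀ σ ∈ Ind, σ ⊆ M
  downward_closed : ∀ σ ∈ Ind, ∀ τ ⊆ σ, τ ∈ Ind
  exchange : ∀ σ ∈ Ind, ∀ τ ∈ Ind, σ.Finite → τ.Finite → τ.ncard < σ.ncard →
    ∃ x ∈ σ \ τ, insert x τ ∈ Ind

namespace PiSpace

variable {α : Type*}

/-- Condition (FC): a pi-space is a finitary matroid if every set all of whose finite
subsets are independent is itself independent. -/
def Finitary (P : PiSpace α) : Prop :=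
  ∀ σ ⊆ P.M, (∀ τ ⊆ σ, τ.Finite → τ ∈ P.Ind) → σ ∈ P.Ind

/-- The set of finite independent sets `I(M)_fin`. -/
def IndFin (P : PiSpace α) : Set (Set α) := {σ ∈ P.Ind | σ.Finite}

/-- The family `I(M)_W` of sets all of whose finite subsets are independent. -/
def IndW (P : PiSpace α) : Set (Set α) :=
  {σ | σ ⊆ P.M ∧ ∀ τ ⊆ σ, τ.Finite → τ ∈ P.Ind}

/-- The independent sets contained in `N`, i.e. `I(M,N)`. -/
def restrictInd (P : PiSpace α) (N : Set α) : Set (Set α) := {σ ∈ P.Ind | σ ⊆ N}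

/-- `I(M.X)`: independent sets of the contraction of `M` by `M \ X`. -/
def contractInd (P : PiSpace α) (X : Set α) : Set (Set α) :=
  {σ ∈ P.restrictInd X | ∃ τ ∈ P.restrictInd (P.M \ X),
    (∀ ρ ∈ P.restrictInd (P.M \ X), τ ⊆ ρ → ρ = τ) ∧ σ ∪ τ ∈ P.Ind}

/-- The rank of a subset `X`: the supremum of the cardinalities (in `ℕ∞`) of the
independent sets contained in `X`. -/
noncomputable def rk (P : PiSpace α) (X : Set α) : ℕ∞ :=
  ⨆ σ ∈ {σ : Set α | σ ∈ P.Ind ∧ σ ⊆ X}, σ.encard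

/-- A flat of a pi-space. -/
def IsFlat (P : PiSpace α) (F : Set α) : Prop :=
  F ⊆ P.M ∧ ∀ x ∈ P.M \ F, ∀ σ ∈ P.Ind, σ ⊆ F → insert x σ ∈ P.Ind

/-- The set of loops `0_{I(M)}`. -/
def loops (P : PiSpace α) : Set α := {x ∈ P.M | {x} ∉ P.Ind}

/-- A dependent subset of `M`. -/
def Dep (P : PiSpace α) (X : Set α) : Prop := X ⊆ P.M ∧ X ∉ P.Ind

/-- A circuit: a minimal dependent set. -/
def IsCircuit (P : PiSpace α) (C : Set α) : Prop :=
  P.Dep C ∧ ∀ C' ⊂ C, C' ∈ P.Ind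

/-- The closure of a subset `X`. -/
def cl (P : PiSpace α) (X : Set α) : Set α :=
  X ∪ {x ∈ P.M | ∃ C, P.IsCircuit C ∧ x ∈ C ∧ C ⊆ X ∪ {x}}

/-- The join of two flats: the intersection of all flats containing both. -/
def flatJoin (P : PiSpace α) (F G : Set α) : Set α :=
  ⋂₀ {H | P.IsFlat H ∧ F ⊆ H ∧ G ⊆ H}

/-- `Φ(σ)`: the intersection of all flats containing `σ`. -/
def Phi (P : PiSpace α) (σ : Set α) : Set α := ⋂₀ {F | P.IsFlat F ∧ σ ⊆ F}

/-- A finitely closed set: it contains the closure of each of its finite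
independent subsets. -/
def FinitelyClosed (P : PiSpace α) (X : Set α) : Prop :=
  ∀ σ ∈ P.Ind, σ ⊆ X → σ.Finite → P.cl σ ⊆ X

/-- An atom of the poset of flats: a flat strictly containing the loops and
minimal with this property. -/
def IsFlatAtom (P : PiSpace α) (A : Set α) : Prop :=
  P.IsFlat A ∧ P.loops ⊂ A ∧ ∀ F, P.IsFlat F → P.loops ⊂ F → F ⊆ A → F = A

end PiSpace

/-- Flats of an arbitrary pair (ground set, family of independent sets). -/
def IsFlatIn {α : Type*} (Mset : Set α) (Ind : Set (Set α)) (F : Set α) : Prop :=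
  F ⊆ Mset ∧ ∀ x ∈ Mset \ F, ∀ σ ∈ Ind, σ ⊆ F → insert x σ ∈ Ind

/-- The rank of `X` with respect to a family `Ind` of independent sets. -/
noncomputable def rkIn {α : Type*} (Ind : Set (Set α)) (X : Set α) : ℕ∞ :=
  ⨆ σ ∈ {σ : Set α | σ ∈ Ind ∧ σ ⊆ X}, σ.encard

namespace PiSpace

variable {α : Type*} {P : PiSpace α} {F G : Set α}

lemma encard_le_rk {X σ : Set α} (hσ : σ ∈ P.Ind) (hX : σ ⊆ X) : σ.encard ≤ P.rk X :=
  le_iSup₂_of_le σ ⟨hσ, hX⟩ le_rfl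

/-- The matroid whose independent sets are those of a pi-space of finite rank. -/
noncomputable def toMatroid (P : PiSpace α) (hfin : P.rk P.M < ⊤) : Matroid α :=
  (IndepMatroid.ofBddAugment P.M (· ∈ P.Ind)
    (by
      obtain ⟨σ, hσ⟩ := P.Ind_nonempty
      exact P.downward_closed σ hσ ∅ (empty_subset σ))
    (fun I J hJ hIJ ↦ P.downward_closed J hJ I hIJ)
    (by
      intro I J hI hJ hlt
      have hfinite : ∀ K ∈ P.Ind, K.Finite := fun K hK ↦
        encard_lt_top_iff.1 ((encard_le_rk hK (P.ind_subset_M K hK)).trans_lt hfin)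
      have hI' := hfinite I hI
      have hJ' := hfinite J hJ
      obtain ⟨x, hx, hxI⟩ := P.exchange J hJ I hI hJ' hI' (by
        rwa [← hI'.cast_ncard_eq, ← hJ'.cast_ncard_eq, Nat.cast_lt] at hlt)
      exact ⟨x, hx.1, hx.2, hxI⟩)
    (by
      obtain ⟨n, hn⟩ := ENat.ne_top_iff_exists.1 hfin.ne
      exact ⟨n, fun I hI ↦ hn ▸ encard_le_rk hI (P.ind_subset_M I hI)⟩)
    P.ind_subset_M).matroid

@[simp] lemma toMatroid_E (hfin : P.rk P.M < ⊤) : (P.toMatroid hfin).E = P.M := rfl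

@[simp] lemma toMatroid_indep (hfin : P.rk P.M < ⊤) {I : Set α} :
    (P.toMatroid hfin).Indep I ↔ I ∈ P.Ind := by
  simp [toMatroid, IndepMatroid.ofBddAugment, IndepMatroid.ofBdd]

lemma toMatroid_eRk (hfin : P.rk P.M < ⊤) (X : Set α) : (P.toMatroid hfin).eRk X = P.rk X := by
  apply le_antisymm
  · rw [Matroid.eRk_le_iff]
    exact fun I hIX hI ↦ encard_le_rk ((toMatroid_indep hfin).1 hI) hIX
  · exact iSup₂_le fun σ hσ ↦
      ((toMatroid_indep hfin).2 hσ.1).encard_le_eRk_of_subset hσ.2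

lemma toMatroid_isFlat_iff (hfin : P.rk P.M < ⊤) :
    (P.toMatroid hfin).IsFlat F ↔ P.IsFlat F := by
  refine ⟨fun h ↦ ⟨h.subset_ground, fun x hx σ hσ hσF ↦ ?_⟩, fun h ↦ ?_⟩
  · have hσ' := (toMatroid_indep hfin).2 hσ
    have hxσ : x ∉ (P.toMatroid hfin).closure σ := fun hxσ ↦
      hx.2 (h.closure ▸ Matroid.closure_subset_closure _ hσF hxσ)
    exact (toMatroid_indep hfin).1 (((hσ'.notMem_closure_iff hx.1).1 hxσ).1)
  · rw [Matroid.isFlat_iff_closure_eq]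
    refine Subset.antisymm (fun x hx ↦ ?_) (Matroid.subset_closure _ F h.1)
    by_contra hxF
    obtain ⟨I, hI⟩ := (P.toMatroid hfin).exists_isBasis F h.1
    have hxM : x ∈ P.M := Matroid.closure_subset_ground _ F hx
    have hins := (toMatroid_indep hfin).2
      (h.2 x ⟨hxM, hxF⟩ I ((toMatroid_indep hfin).1 hI.indep) hI.subset)
    rw [← hI.closure_eq_closure] at hx
    exact (hI.indep.notMem_closure_iff hxM).2 ⟨hins, fun hxI ↦ hxF (hI.subset hxI)⟩ hx

lemma toMatroid_closure_union (hfin : P.rk P.M < ⊤) (hF : P.IsFlat F) (hG : P.IsFlat G) :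
    (P.toMatroid hfin).closure (F ∪ G) = P.flatJoin F G := by
  rw [Matroid.closure_def' _ _ (union_subset hF.1 hG.1)]
  simp only [toMatroid_isFlat_iff, union_subset_iff, flatJoin]

lemma toMatroid_loops (hfin : P.rk P.M < ⊤) : (P.toMatroid hfin).loops = P.loops := by
  ext x
  refine ⟨fun hx ↦ ⟨Matroid.IsLoop.mem_ground hx, fun h ↦ ?_⟩, fun hx ↦ ?_⟩
  · exact Matroid.IsLoop.not_isNonloop hx
      (Matroid.indep_singleton.1 ((toMatroid_indep hfin).2 h))
  · refine Matroid.isLoop_of_not_isNonloop hx.1 fun h ↦ hx.2 ?_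
    exact (toMatroid_indep hfin).1 (Matroid.indep_singleton.2 h)

lemma isFlatAtom_closure_singleton (hfin : P.rk P.M < ⊤) {x : α}
    (hx : (P.toMatroid hfin).IsNonloop x) :
    P.IsFlatAtom ((P.toMatroid hfin).closure {x}) := by
  have hxx := Matroid.mem_closure_of_mem' (P.toMatroid hfin) (mem_singleton x) hx.mem_ground
  refine ⟨(toMatroid_isFlat_iff hfin).1 (Matroid.isFlat_closure _), ?_, fun H hH hlt hle ↦ ?_⟩
  · rw [← toMatroid_loops hfin]
    exact ssubset_iff_of_subset (Matroid.isFlat_closure _).loops_subset |>.2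
      ⟨x, hxx, fun h ↦ Matroid.IsLoop.not_isNonloop h hx⟩
  · rw [← toMatroid_loops hfin] at hlt
    obtain ⟨y, hyH, hy⟩ := exists_of_ssubset hlt
    have hyn := Matroid.isNonloop_of_not_isLoop (hH.1 hyH) hy
    refine hle.antisymm ?_
    rw [← hyn.closure_eq_of_mem_closure (hle hyH),
      ← ((toMatroid_isFlat_iff hfin).2 hH).closure]
    exact Matroid.closure_subset_closure _ (singleton_subset_iff.2 hyH)

lemma IsFlat.rk_insert (hfin : P.rk P.M < ⊤) (hF : P.IsFlat F) {x : α} (hx : x ∈ P.M \ F) :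
    P.rk (insert x F) = P.rk F + 1 := by
  rw [← toMatroid_eRk hfin, ← toMatroid_eRk hfin]
  exact Matroid.eRk_insert_eq_add_one (((toMatroid_isFlat_iff hfin).2 hF).closure.symm ▸ hx)

lemma rk_mono : Monotone P.rk := fun _ _ h ↦
  iSup₂_le fun _ hσ ↦ encard_le_rk hσ.1 (hσ.2.trans h)

end PiSpace

/-- For a pi-space of finite rank, the lattice of flats is ranked (with
rank function `rk`), atomistic, and semimodular. -/
theorem flats_geometric_lattice {α : Type*} (P : PiSpace α) (hfin : P.rk P.M < ⊤) :
    -- (1) lattice with rank function rk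
    ((∀ F G, P.IsFlat F → P.IsFlat G →
        P.IsFlat (F ∩ G) ∧ P.IsFlat (P.flatJoin F G)) ∧
     (∀ F G, P.IsFlat F → P.IsFlat G → F ⊂ G → P.rk F < P.rk G) ∧
     (∀ F G, P.IsFlat F → P.IsFlat G → F ⊂ G →
        (∀ H, P.IsFlat H → F ⊂ H → H ⊆ G → H = G) → P.rk G = P.rk F + 1)) ∧
    -- (2) atomistic: every flat is the join of the atoms below it
    (∀ F, P.IsFlat F →
      F = ⋂₀ {G | P.IsFlat G ∧ ∀ A, P.IsFlatAtom A → A ⊆ F → A ⊆ G}) ∧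
    -- (3) semimodular
    (∀ F G, P.IsFlat F → P.IsFlat G →
      P.rk (P.flatJoin F G) + P.rk (F ∩ G) ≤ P.rk F + P.rk G) := by
  refine ⟨⟨fun F G hF hG ↦ ⟨?_, ?_⟩, fun F G hF hG hlt ↦ ?_, fun F G hF hG hlt hcov ↦ ?_⟩,
    fun F hF ↦ ?_, fun F G hF hG ↦ ?_⟩
  · exact ⟨inter_subset_left.trans hF.1, fun x hx σ hσ hσFG ↦
      (not_and_or.1 hx.2).elim
        (fun h ↦ hF.2 x ⟨hx.1, h⟩ σ hσ (hσFG.trans inter_subset_left))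
        (fun h ↦ hG.2 x ⟨hx.1, h⟩ σ hσ (hσFG.trans inter_subset_right))⟩
  · rw [← PiSpace.toMatroid_closure_union hfin hF hG]
    exact (PiSpace.toMatroid_isFlat_iff hfin).1 (Matroid.isFlat_closure _)
  · obtain ⟨x, hxG, hxF⟩ := exists_of_ssubset hlt
    have hne : P.rk F ≠ ⊤ := ((PiSpace.rk_mono hF.1).trans_lt hfin).ne
    calc P.rk F < P.rk F + 1 := ENat.lt_add_one_iff hne |>.2 le_rfl
      _ = P.rk (insert x F) := (hF.rk_insert hfin ⟨hG.1 hxG, hxF⟩).symm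
      _ ≤ P.rk G := PiSpace.rk_mono (insert_subset hxG hlt.subset)
  · obtain ⟨x, hxG, hxF⟩ := exists_of_ssubset hlt
    have hsub : insert x F ⊆ (P.toMatroid hfin).closure (insert x F) :=
      Matroid.subset_closure _ _ (insert_subset (hG.1 hxG) hF.1)
    have hcl : (P.toMatroid hfin).closure (insert x F) = G := by
      refine hcov _ ((PiSpace.toMatroid_isFlat_iff hfin).1 (Matroid.isFlat_closure _))
        ((ssubset_insert hxF).trans_subset hsub) ?_
      rw [← ((PiSpace.toMatroid_isFlat_iff hfin).2 hG).closure]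
      exact Matroid.closure_subset_closure _ (insert_subset hxG hlt.subset)
    rw [← hF.rk_insert hfin ⟨hG.1 hxG, hxF⟩, ← hcl, ← PiSpace.toMatroid_eRk hfin,
      Matroid.eRk_closure_eq, PiSpace.toMatroid_eRk]
  · refine (subset_sInter fun G hG x hx ↦ ?_).antisymm
      (sInter_subset_of_mem ⟨hF, fun _ _ h ↦ h⟩)
    by_cases hxl : (P.toMatroid hfin).IsLoop x
    · exact hxl.mem_of_isFlat ((PiSpace.toMatroid_isFlat_iff hfin).2 hG.1)
    · have hxn := Matroid.isNonloop_of_not_isLoop (hF.1 hx) hxl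
      refine hG.2 _ (PiSpace.isFlatAtom_closure_singleton hfin hxn) ?_
        (Matroid.mem_closure_of_mem' _ (mem_singleton x) hxn.mem_ground)
      rw [← ((PiSpace.toMatroid_isFlat_iff hfin).2 hF).closure]
      exact Matroid.closure_subset_closure _ (singleton_subset_iff.2 hx)
  · rw [← PiSpace.toMatroid_closure_union hfin hF hG]
    simp only [← PiSpace.toMatroid_eRk hfin, Matroid.eRk_closure_eq]
    rw [add_comm]
    exact Matroid.eRk_inter_add_eRk_union_le _ F G
end

section
/- Let (M, I(M)) be a pi-space and let σ ∈ I(M) be a finite independent set. Then rk(Cl(σ)) = |σ|, and Cl(σ) is a flat. -/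
open Set

namespace PiSpace

theorem insert_mem_ind_of_notMem_cl {α : Type*} (P : PiSpace α) {σ : Set α} (hσ : σ ∈ P.Ind)
    (hfin : σ.Finite) {x : α} (hxM : x ∈ P.M) (hx : x ∉ P.cl σ) : insert x σ ∈ P.Ind := by
  by_contra hdep
  obtain ⟨C, hC, hmin⟩ := ((hfin.insert x).finite_subsets.subset
    (fun _ h => h.1 : {C | C ⊆ insert x σ ∧ C ∉ P.Ind} ⊆ _)).exists_minimal
      ⟨_, Subset.rfl, hdep⟩
  have hCM : C ⊆ P.M := hC.1.trans (insert_subset hxM (P.ind_subset_M σ hσ))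
  have hxC : x ∈ C := by
    by_contra h
    exact hC.2 (P.downward_closed σ hσ C ((subset_insert_iff_of_notMem h).1 hC.1))
  refine hx (Or.inr ⟨hxM, C, ⟨⟨hCM, hC.2⟩, fun C' hC' => ?_⟩, hxC, ?_⟩)
  · by_contra h
    exact hC'.2 (hmin ⟨hC'.1.trans hC.1, h⟩ hC'.1)
  · rw [union_singleton]
    exact hC.1

theorem insert_notMem_ind_of_mem_cl {α : Type*} (P : PiSpace α) {σ : Set α} {x : α} (hx : x ∈ P.cl σ)
    (hxσ : x ∉ σ) : insert x σ ∉ P.Ind := by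
  obtain h | ⟨-, C, hC, -, hCσ⟩ := hx
  · exact absurd h hxσ
  · rw [union_singleton] at hCσ
    exact fun h => hC.1.2 (P.downward_closed _ h C hCσ)

theorem encard_le_of_subset_cl {α : Type*} (P : PiSpace α) {σ τ : Set α} (hσ : σ ∈ P.Ind)
    (hfin : σ.Finite) (hτ : τ ∈ P.Ind) (hτσ : τ ⊆ P.cl σ) : τ.encard ≤ σ.encard := by
  by_contra! hlt
  obtain ⟨ρ, hρτ, hρ⟩ := exists_subset_encard_eq (Order.add_one_le_of_lt hlt)
  have hρfin : ρ.Finite := by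
    rw [← encard_lt_top_iff, hρ, ← hfin.cast_ncard_eq]
    exact ENat.natCast_lt_top (σ.ncard + 1)
  have hcard : σ.ncard < ρ.ncard := by
    rw [← hfin.cast_ncard_eq, ← hρfin.cast_ncard_eq] at hρ
    have : ρ.ncard = σ.ncard + 1 := by exact_mod_cast hρ
    omega
  obtain ⟨x, hx, hxσ⟩ :=
    P.exchange ρ (P.downward_closed τ hτ ρ hρτ) σ hσ hρfin hfin hcard
  exact P.insert_notMem_ind_of_mem_cl (hτσ (hρτ hx.1)) hx.2 hxσ

theorem cl_subset_M {α : Type*} (P : PiSpace α) {X : Set α} (hX : X ⊆ P.M) : P.cl X ⊆ P.M :=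
  union_subset hX fun _ h => h.1

theorem insert_mem_ind_of_subset_cl {α : Type*} (P : PiSpace α) {σ : Set α} (hσ : σ ∈ P.Ind)
    (hfin : σ.Finite) {x : α} (hxM : x ∈ P.M) (hx : x ∉ P.cl σ) (τ : Set α) (hτ : τ ∈ P.Ind)
    (hτσ : τ ⊆ P.cl σ) : insert x τ ∈ P.Ind := by
  have hle := P.encard_le_of_subset_cl hσ hfin hτ hτσ
  have hτfin : τ.Finite := finite_of_encard_le_coe (hle.trans hfin.cast_ncard_eq.ge)
  have hcard : τ.ncard ≤ σ.ncard := by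
    rw [← hfin.cast_ncard_eq, ← hτfin.cast_ncard_eq] at hle
    exact_mod_cast hle
  have hxσ : x ∉ σ := fun h => hx (Or.inl h)
  have hcard' := ncard_insert_of_notMem hxσ hfin
  obtain ⟨y, ⟨hy, hyτ⟩, hyI⟩ := P.exchange _ (P.insert_mem_ind_of_notMem_cl hσ hfin hxM hx) τ hτ
    (hfin.insert x) hτfin (by omega)
  obtain rfl | hyσ := hy
  · exact hyI
  · have hcard'' := ncard_insert_of_notMem hyτ hτfin
    have hsub : insert y τ ⊆ P.cl σ := insert_subset (Or.inl hyσ) hτσ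
    have hle' := P.encard_le_of_subset_cl hσ hfin hyI hsub
    rw [← hfin.cast_ncard_eq, ← (hτfin.insert y).cast_ncard_eq] at hle'
    have hle'' : (insert y τ).ncard ≤ σ.ncard := by exact_mod_cast hle'
    exact P.downward_closed _
      (insert_mem_ind_of_subset_cl P hσ hfin hxM hx (insert y τ) hyI hsub) _
      (insert_subset_insert (subset_insert y τ))
termination_by σ.ncard - τ.ncard
decreasing_by omega

end PiSpace

/-- For a finite independent set `σ`, `rk(Cl(σ)) = |σ|` and `Cl(σ)`
is a flat. -/
theorem closure_of_finite_independent {α : Type*} (P : PiSpace α) (σ : Set α)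
    (hσ : σ ∈ P.Ind) (hfin : σ.Finite) :
    P.rk (P.cl σ) = σ.encard ∧ P.IsFlat (P.cl σ) := by
  refine ⟨le_antisymm (iSup₂_le fun τ hτ => P.encard_le_of_subset_cl hσ hfin hτ.1 hτ.2) ?_,
    P.cl_subset_M (P.ind_subset_M σ hσ), fun x hx τ hτ hτσ =>
      P.insert_mem_ind_of_subset_cl hσ hfin hx.1 hx.2 τ hτ hτσ⟩
  exact le_iSup₂_of_le σ ⟨hσ, subset_union_left⟩ le_rfl
end

section
/- Let (M, I(M)) be a pi-space. Then: (1) every flat is a closed set, i.e., L(M, I(M)) ⊆ C(M, I(M)), and if every dependent subset of M contains a circuit then every closed set is a flat, i.e., L(M, I(M)) = C(M, I(M)); (2) the closed sets of finite rank coincide with the flats of finite rank, i.e., L(M, I(M))_fin = C(M, I(M))_fin. -/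
open Set

namespace PiSpace

variable {α : Type*}

theorem IsFlat.cl_eq {P : PiSpace α} {F : Set α} (hF : P.IsFlat F) : P.cl F = F := by
  refine Subset.antisymm (union_subset Subset.rfl ?_) subset_union_left
  rintro x ⟨hxM, C, ⟨hdep, hmin⟩, hxC, hCF⟩
  by_contra hxF
  refine hdep.2 ?_
  have hsub : C \ {x} ⊆ F := fun y hy => (hCF hy.1).resolve_right hy.2
  have hind := hF.2 x ⟨hxM, hxF⟩ (C \ {x}) (hmin _ (sdiff_singleton_ssubset.2 hxC)) hsub
  rwa [insert_sdiff_singleton, insert_eq_of_mem hxC] at hind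

theorem isFlat_of_cl_eq {P : PiSpace α} {Y : Set α} (hYM : Y ⊆ P.M) (hY : P.cl Y = Y)
    (hcirc : ∀ x ∈ P.M, ∀ σ ∈ P.Ind, σ ⊆ Y → P.Dep (insert x σ) →
      ∃ C, P.IsCircuit C ∧ C ⊆ insert x σ) : P.IsFlat Y := by
  refine ⟨hYM, fun x hx σ hσ hσY => ?_⟩
  by_contra hdep
  obtain ⟨C, hC, hCσ⟩ :=
    hcirc x hx.1 σ hσ hσY ⟨insert_subset hx.1 (hσY.trans hYM), hdep⟩
  have hxC : x ∈ C := by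
    by_contra hxC
    exact hC.1.2 (P.downward_closed σ hσ C ((subset_insert_iff_of_notMem hxC).1 hCσ))
  refine hx.2 (hY ▸ Or.inr ⟨hx.1, C, hC, hxC, hCσ.trans ?_⟩)
  exact insert_subset (Or.inr rfl) (hσY.trans subset_union_left)

theorem Dep.exists_isCircuit_subset {P : PiSpace α} {D : Set α} (hD : P.Dep D)
    (hfin : D.Finite) : ∃ C, P.IsCircuit C ∧ C ⊆ D := by
  have hfin' : {C | C ⊆ D ∧ C ∉ P.Ind}.Finite := hfin.finite_subsets.subset fun _ hC => hC.1
  obtain ⟨C, hC⟩ := hfin'.exists_minimal ⟨D, Subset.rfl, hD.2⟩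
  refine ⟨C, ⟨⟨hC.prop.1.trans hD.1, hC.prop.2⟩, fun C' hC' => ?_⟩, hC.prop.1⟩
  by_contra hind
  exact hC'.not_subset (hC.le_of_le ⟨hC'.subset.trans hC.prop.1, hind⟩ hC'.subset)

theorem finite_of_rk_lt_top {P : PiSpace α} {Y σ : Set α} (hY : P.rk Y < ⊤) (hσ : σ ∈ P.Ind)
    (hσY : σ ⊆ Y) : σ.Finite :=
  encard_lt_top_iff.1 <| (le_iSup₂_of_le (f := fun (τ : Set α)
    (_ : τ ∈ {τ : Set α | τ ∈ P.Ind ∧ τ ⊆ Y}) => τ.encard) σ ⟨hσ, hσY⟩ le_rfl).trans_lt hY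

end PiSpace

/-- (1) every flat is closed, and if every dependent set contains a
circuit then every closed set is a flat; (2) the closed sets of finite rank are
exactly the flats of finite rank. -/
theorem flats_and_closed_sets {α : Type*} (P : PiSpace α) :
    (∀ F, P.IsFlat F → P.cl F = F) ∧
    ((∀ D, P.Dep D → ∃ C, P.IsCircuit C ∧ C ⊆ D) →
      ∀ Y ⊆ P.M, P.cl Y = Y → P.IsFlat Y) ∧
    (∀ Y ⊆ P.M, ((P.cl Y = Y ∧ P.rk Y < ⊤) ↔ (P.IsFlat Y ∧ P.rk Y < ⊤))) := by
  refine ⟨fun F hF => hF.cl_eq, fun hcirc Y hYM hY => ?_, fun Y hYM => ⟨?_, ?_⟩⟩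
  · exact PiSpace.isFlat_of_cl_eq hYM hY fun x _ σ _ _ hdep => hcirc _ hdep
  · rintro ⟨hY, hrk⟩
    refine ⟨PiSpace.isFlat_of_cl_eq hYM hY fun x _ σ hσ hσY hdep => ?_, hrk⟩
    exact hdep.exists_isCircuit_subset ((PiSpace.finite_of_rk_lt_top hrk hσ hσY).insert x)
  · exact fun h => ⟨h.1.cl_eq, h.2⟩
end
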